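/- arXiv:1409.5383 — 2 statements merged into one kernel-verified Lean document; each statement's English description precedes it below -/
import Mathlib

section
/- Let 2 ≤ α ≤ n−1 and let S be a Nash equilibrium of the SUM-game with S ≠ V. Then |S| ≤ ⌈α⌉, every non-gateway x ∈ V∖S satisfies d(x,S) ≤ 2⌈√α⌉, and the social cost satisfies c(S) ≤ nα + 2n²⌈√α⌉. -/
open Finset

/-- Distance from a node `u` to the gateway set `S` (hop distance to nearest gateway). -/
noncomputable def gwDist {V : Type*} (G : SimpleGraph V) (S : Finset V) (u : V) : ℕ :=
  sInf ((fun s => G.dist u s) '' (S : Set V))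

/-- Communication distance `δ_S(u,v) = min{d(u,v), d(u,S) + d(S,v)}`. -/
noncomputable def comDist {V : Type*} (G : SimpleGraph V) (S : Finset V) (u v : V) : ℕ :=
  min (G.dist u v) (gwDist G S u + gwDist G S v)

/-- Private cost of node `v` in the SUM-game. -/
noncomputable def sumCost {V : Type*} [Fintype V] [DecidableEq V]
    (G : SimpleGraph V) (α : ℝ) (S : Finset V) (v : V) : ℝ :=
  (if v ∈ S then α else 0) + ∑ u : V, (comDist G S v u : ℝ)

/-- Social cost of the SUM-game. -/
noncomputable def sumSocial {V : Type*} [Fintype V] [DecidableEq V]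
    (G : SimpleGraph V) (α : ℝ) (S : Finset V) : ℝ :=
  ∑ v : V, sumCost G α S v

/-- `v` performs an improving response changing profile `S` into `S'` in the SUM-game. -/
def SumIRBy {V : Type*} [Fintype V] [DecidableEq V]
    (G : SimpleGraph V) (α : ℝ) (v : V) (S S' : Finset V) : Prop :=
  ((v ∉ S ∧ S' = insert v S) ∨ (v ∈ S ∧ S' = S.erase v ∧ (S.erase v).Nonempty)) ∧
    sumCost G α S' v < sumCost G α S v

/-- `S'` arises from `S` by an improving response in the SUM-game. -/
def SumIR {V : Type*} [Fintype V] [DecidableEq V]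
    (G : SimpleGraph V) (α : ℝ) (S S' : Finset V) : Prop :=
  ∃ v, SumIRBy G α v S S'

/-- `S` is a Nash equilibrium of the SUM-game: no node has an improving response. -/
def SumNash {V : Type*} [Fintype V] [DecidableEq V]
    (G : SimpleGraph V) (α : ℝ) (S : Finset V) : Prop :=
  ∀ S', ¬ SumIR G α S S'

theorem gwDist_le_dist {V : Type*} (G : SimpleGraph V) {S : Finset V} {s : V} (hs : s ∈ S)
    (u : V) : gwDist G S u ≤ G.dist u s :=
  Nat.sInf_le ⟨s, hs, rfl⟩

theorem exists_gwDist_eq_dist {V : Type*} (G : SimpleGraph V) {S : Finset V} (hS : S.Nonempty)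
    (u : V) : ∃ s ∈ S, G.dist u s = gwDist G S u :=
  Nat.sInf_mem (s := (fun s => G.dist u s) '' (S : Set V)) (hS.to_set.image _)

theorem gwDist_eq_zero_of_mem {V : Type*} (G : SimpleGraph V) {S : Finset V} {u : V}
    (hu : u ∈ S) : gwDist G S u = 0 := by
  simpa using gwDist_le_dist G hu u

theorem gwDist_pos_of_notMem {V : Type*} {G : SimpleGraph V} (hG : G.Connected) {S : Finset V}
    (hS : S.Nonempty) {u : V} (hu : u ∉ S) : 0 < gwDist G S u := by
  obtain ⟨s, hs, h⟩ := exists_gwDist_eq_dist G hS u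
  rw [← h]
  exact hG.pos_dist_of_ne (by rintro rfl; exact hu hs)

theorem gwDist_anti {V : Type*} (G : SimpleGraph V) {S T : Finset V} (hS : S.Nonempty)
    (hST : S ⊆ T) (u : V) : gwDist G T u ≤ gwDist G S u := by
  obtain ⟨s, hs, h⟩ := exists_gwDist_eq_dist G hS u
  exact h ▸ gwDist_le_dist G (hST hs) u

/-- In a Nash equilibrium, the total saving that a non-gateway `x` would make by opening, counted
on any set `A` of nodes, is at most `α`. -/
theorem SumNash.sum_comDist_le {V : Type*} [Fintype V] [DecidableEq V] {G : SimpleGraph V}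
    {α : ℝ} {S : Finset V} (hNash : SumNash G α S) (hS : S.Nonempty) {x : V} (hx : x ∉ S)
    (A : Finset V) :
    ((∑ u ∈ A, comDist G S x u : ℕ) : ℝ) ≤
      α + ((∑ u ∈ A, min (G.dist x u) (gwDist G S u) : ℕ) : ℝ) := by
  have hopen : sumCost G α S x ≤ sumCost G α (insert x S) x :=
    not_lt.mp fun h => hNash _ ⟨x, Or.inl ⟨hx, rfl⟩, h⟩
  simp only [sumCost, hx, mem_insert_self, if_true, if_false, zero_add] at hopen
  have hle : ∀ u, comDist G (insert x S) x u ≤ min (G.dist x u) (gwDist G S u) := fun u => by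
    have h0 := gwDist_eq_zero_of_mem G (mem_insert_self x S)
    have h1 := gwDist_anti G hS (subset_insert x S) u
    simp only [comDist]
    omega
  have hge : ∀ u, min (G.dist x u) (gwDist G S u) ≤ comDist G S x u := fun u => by
    simp only [comDist]
    omega
  have h1 : ∑ u, comDist G (insert x S) x u ≤ ∑ u, min (G.dist x u) (gwDist G S u) :=
    sum_le_sum fun u _ => hle u
  have h2 : ∑ u ∈ univ \ A, min (G.dist x u) (gwDist G S u) ≤ ∑ u ∈ univ \ A, comDist G S x u :=
    sum_le_sum fun u _ => hge u
  rw [← sum_sdiff (f := fun u => min (G.dist x u) (gwDist G S u)) (subset_univ A)] at h1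
  rw [← Nat.cast_sum, ← Nat.cast_sum, ← sum_sdiff (subset_univ A)] at hopen
  have h1' := (Nat.cast_le (α := ℝ)).mpr h1
  have h2' := (Nat.cast_le (α := ℝ)).mpr h2
  push_cast at *
  linarith

theorem sq_le_four_mul_sum_two_mul_sub (D : ℕ) :
    D ^ 2 ≤ 4 * ∑ i ∈ range (D + 1), (2 * i - D) := by
  induction D using Nat.twoStepInduction with
  | zero => simp
  | one => decide
  | more D ih _ =>
    have h : ∀ i, 2 * (i + 1) - (D + 2) = 2 * i - D := fun i => by omega
    rw [sum_range_succ', sum_congr rfl fun i _ => h i, sum_range_succ]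
    have : 2 * (D + 1) - D = D + 2 := by omega
    rw [this]
    nlinarith

/-- A shortest path from `x` to its nearest gateway, listed by distance from `x`. -/
theorem exists_path_to_gateway {V : Type*} {G : SimpleGraph V} (hG : G.Connected) {S : Finset V}
    (hS : S.Nonempty) (x : V) :
    ∃ v : ℕ → V, ∀ i ≤ gwDist G S x, G.dist x (v i) = i ∧ gwDist G S (v i) ≤ gwDist G S x - i := by
  obtain ⟨s, hs, h⟩ := exists_gwDist_eq_dist G hS x
  obtain ⟨p, hp⟩ := hG.exists_walk_length_eq_dist x s
  refine ⟨p.getVert, fun i hi => ?_⟩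
  have h1 := SimpleGraph.dist_le (p.take i)
  have h2 := SimpleGraph.dist_le (p.drop i)
  rw [SimpleGraph.Walk.take_length] at h1
  rw [SimpleGraph.Walk.drop_length] at h2
  have h3 := hG.dist_triangle (u := x) (v := p.getVert i) (w := s)
  have h4 := gwDist_le_dist G hs (p.getVert i)
  omega

theorem SumNash.gwDist_sq_le {V : Type*} [Fintype V] [DecidableEq V] {G : SimpleGraph V}
    (hG : G.Connected) {α : ℝ} {S : Finset V} (hNash : SumNash G α S) (hS : S.Nonempty) {x : V}
    (hx : x ∉ S) : (gwDist G S x : ℝ) ^ 2 ≤ 4 * α := by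
  obtain ⟨v, hv⟩ := exists_path_to_gateway hG hS x
  have hinj : Set.InjOn v (range (gwDist G S x + 1)) := fun i hi j hj hij => by
    simp only [coe_range, Set.mem_Iio, Nat.lt_succ_iff] at hi hj
    rw [← (hv i hi).1, ← (hv j hj).1, hij]
  have h := hNash.sum_comDist_le hS hx ((range (gwDist G S x + 1)).image v)
  rw [sum_image hinj, sum_image hinj] at h
  have hsum : ∑ i ∈ range (gwDist G S x + 1), min (G.dist x (v i)) (gwDist G S (v i)) +
      ∑ i ∈ range (gwDist G S x + 1), (2 * i - gwDist G S x) ≤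
      ∑ i ∈ range (gwDist G S x + 1), comDist G S x (v i) := by
    rw [← sum_add_distrib]
    refine sum_le_sum fun i hi => ?_
    have hi' : i ≤ gwDist G S x := Nat.lt_succ_iff.mp (mem_range.mp hi)
    obtain ⟨h1, h2⟩ := hv i hi'
    simp only [comDist]
    omega
  have hsum' := (Nat.cast_le (α := ℝ)).mpr hsum
  have hsq := (Nat.cast_le (α := ℝ)).mpr (sq_le_four_mul_sum_two_mul_sub (gwDist G S x))
  rw [Nat.cast_add] at hsum'
  rw [Nat.cast_pow, Nat.cast_mul, Nat.cast_ofNat] at hsq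
  linarith

theorem SumNash.card_le {V : Type*} [Fintype V] [DecidableEq V] {G : SimpleGraph V}
    (hG : G.Connected) {α : ℝ} {S : Finset V} (hNash : SumNash G α S) (hS : S.Nonempty)
    (hSV : S ≠ univ) : (S.card : ℝ) ≤ α := by
  obtain ⟨x, hx⟩ : ∃ x, x ∉ S := by
    by_contra! h
    exact hSV (eq_univ_iff_forall.mpr h)
  have h := hNash.sum_comDist_le hS hx S
  have h0 : ∑ u ∈ S, min (G.dist x u) (gwDist G S u) = 0 :=
    sum_eq_zero fun u hu => by simp [gwDist_eq_zero_of_mem G hu]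
  have h1 : S.card ≤ ∑ u ∈ S, comDist G S x u := by
    rw [card_eq_sum_ones]
    refine sum_le_sum fun u hu => ?_
    have h2 := gwDist_le_dist G hu x
    have h3 := gwDist_pos_of_notMem hG hS hx
    simp only [comDist]
    omega
  have h1' := (Nat.cast_le (α := ℝ)).mpr h1
  rw [h0, Nat.cast_zero] at h
  linarith

theorem SumNash.sumCost_le {V : Type*} [Fintype V] [DecidableEq V] {G : SimpleGraph V}
    {α : ℝ} {S : Finset V} (hNash : SumNash G α S) (hS : S.Nonempty) (x : V) :
    sumCost G α S x ≤ α + ∑ u, (gwDist G S u : ℝ) := by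
  by_cases hx : x ∈ S
  · simp only [sumCost, hx, if_true]
    gcongr with u
    simp [comDist, gwDist_eq_zero_of_mem G hx]
  · have h := hNash.sum_comDist_le hS hx univ
    have h1 : ∑ u, min (G.dist x u) (gwDist G S u) ≤ ∑ u, gwDist G S u :=
      sum_le_sum fun u _ => min_le_right _ _
    have h1' := (Nat.cast_le (α := ℝ)).mpr h1
    simp only [sumCost, hx, if_false, zero_add, ← Nat.cast_sum]
    linarith

/-- For 2 ≤ α ≤ n−1, every Nash equilibrium S ≠ V of the SUM-game satisfies |S| ≤ ⌈α⌉,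
every non-gateway x has d(x,S) ≤ 2⌈√α⌉, and c(S) ≤ nα + 2n²⌈√α⌉. -/
theorem stmt_13 {V : Type*} [Fintype V] [DecidableEq V] (G : SimpleGraph V)
    (hG : G.Connected) (α : ℝ) (h2 : 2 ≤ α) (hαn : α ≤ (Fintype.card V : ℝ) - 1)
    (S : Finset V) (hS : S.Nonempty) (hSV : S ≠ Finset.univ)
    (hNash : SumNash G α S) :
    (S.card : ℝ) ≤ (Nat.ceil α : ℝ) ∧
    (∀ x : V, x ∉ S → gwDist G S x ≤ 2 * Nat.ceil (Real.sqrt α)) ∧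
    sumSocial G α S ≤ (Fintype.card V : ℝ) * α +
      2 * (Fintype.card V : ℝ) ^ 2 * (Nat.ceil (Real.sqrt α) : ℝ) := by
  have hdist : ∀ x : V, x ∉ S → gwDist G S x ≤ 2 * Nat.ceil (Real.sqrt α) := fun x hx => by
    have h := hNash.gwDist_sq_le hG hS hx
    have h1 : (gwDist G S x : ℝ) ≤ 2 * Real.sqrt α := by
      refine abs_le_of_sq_le_sq' ?_ (by positivity) |>.2
      rw [mul_pow, Real.sq_sqrt (by linarith)]
      linarith
    have h2 := Nat.le_ceil (Real.sqrt α)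
    have h3 : (gwDist G S x : ℝ) ≤ 2 * (Nat.ceil (Real.sqrt α) : ℝ) := by linarith
    exact_mod_cast h3
  refine ⟨(hNash.card_le hG hS hSV).trans (Nat.le_ceil α), hdist, ?_⟩
  have hdist' : ∀ u : V, (gwDist G S u : ℝ) ≤ 2 * (Nat.ceil (Real.sqrt α) : ℝ) := fun u => by
    by_cases hu : u ∈ S
    · simp [gwDist_eq_zero_of_mem G hu]
    · exact_mod_cast hdist u hu
  calc sumSocial G α S
      ≤ ∑ _v : V, (α + ∑ _u : V, 2 * (Nat.ceil (Real.sqrt α) : ℝ)) :=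
        sum_le_sum fun v _ => (hNash.sumCost_le hS v).trans (by gcongr; exact hdist' _)
    _ = _ := by
        simp only [sum_const, card_univ, nsmul_eq_mul]
        ring
end

section
/- There exists a constant C > 0 such that for every finite connected simple graph G on n vertices and every real α ≥ 1, every Nash equilibrium S of the MAX-game and every nonempty profile S* satisfy c(S) ≤ C·(1 + n/√α)·c(S*); i.e., the price of anarchy of the MAX-game is O(1 + n/√α) for α ≥ 1. -/
open Finset

/-- Private cost of node `v` in the MAX-game. -/
noncomputable def maxCost {V : Type*} [Fintype V] [DecidableEq V]
    (G : SimpleGraph V) (α : ℝ) (S : Finset V) (v : V) : ℝ :=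
  (if v ∈ S then α else 0) + ((Finset.univ.sup (fun u => comDist G S v u) : ℕ) : ℝ)

/-- Social cost of the MAX-game. -/
noncomputable def maxSocial {V : Type*} [Fintype V] [DecidableEq V]
    (G : SimpleGraph V) (α : ℝ) (S : Finset V) : ℝ :=
  ∑ v : V, maxCost G α S v

/-- `v` performs an improving response changing profile `S` into `S'` in the MAX-game. -/
def MaxIRBy {V : Type*} [Fintype V] [DecidableEq V]
    (G : SimpleGraph V) (α : ℝ) (v : V) (S S' : Finset V) : Prop :=
  ((v ∉ S ∧ S' = insert v S) ∨ (v ∈ S ∧ S' = S.erase v ∧ (S.erase v).Nonempty)) ∧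
    maxCost G α S' v < maxCost G α S v

/-- `S'` arises from `S` by an improving response in the MAX-game. -/
def MaxIR {V : Type*} [Fintype V] [DecidableEq V]
    (G : SimpleGraph V) (α : ℝ) (S S' : Finset V) : Prop :=
  ∃ v, MaxIRBy G α v S S'

/-- `S` is a Nash equilibrium of the MAX-game: no node has an improving response. -/
def MaxNash {V : Type*} [Fintype V] [DecidableEq V]
    (G : SimpleGraph V) (α : ℝ) (S : Finset V) : Prop :=
  ∀ S', ¬ MaxIR G α S S'

section GatewayDistance

variable {V : Type*} {G : SimpleGraph V} {S : Finset V}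

theorem gwDist_le {s : V} (hs : s ∈ S) (u : V) : gwDist G S u ≤ G.dist u s :=
  Nat.sInf_le ⟨s, hs, rfl⟩

theorem exists_dist_eq_gwDist (hS : S.Nonempty) (u : V) :
    ∃ s ∈ S, G.dist u s = gwDist G S u := by
  have hne : ((fun s => G.dist u s) '' (S : Set V)).Nonempty := hS.to_set.image _
  obtain ⟨s, hs, h⟩ := Nat.sInf_mem hne
  exact ⟨s, hs, h⟩

theorem gwDist_le_dist_add (hG : G.Connected) (hS : S.Nonempty) (u v : V) :
    gwDist G S u ≤ G.dist v u + gwDist G S v := by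
  obtain ⟨s, hs, h⟩ := exists_dist_eq_gwDist (G := G) hS v
  rw [← h, G.dist_comm (u := v) (v := u)]
  exact (gwDist_le hs u).trans hG.dist_triangle

/-- Every value up to the distance of two vertices is attained as a distance from the first. -/
theorem exists_dist_eq_of_le_dist (hG : G.Connected) {x y : V} {i : ℕ} (hi : i ≤ G.dist x y) :
    ∃ w, G.dist x w = i := by
  obtain ⟨p, hp⟩ := hG.exists_walk_length_eq_dist x y
  refine ⟨p.getVert i, ?_⟩
  have h₁ := SimpleGraph.dist_le (p.take i)
  have h₂ := SimpleGraph.dist_le (p.drop i)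
  have h₃ : G.dist x y ≤ G.dist x (p.getVert i) + G.dist (p.getVert i) y := hG.dist_triangle
  rw [SimpleGraph.Walk.take_length] at h₁
  rw [SimpleGraph.Walk.drop_length] at h₂
  omega

theorem dist_lt_card [Fintype V] (hG : G.Connected) (x y : V) :
    G.dist x y < Fintype.card V := by
  have h : ∀ i : Fin (G.dist x y + 1), ∃ w, G.dist x w = i := fun i =>
    exists_dist_eq_of_le_dist hG (Nat.lt_succ_iff.mp i.2)
  choose f hf using h
  have hinj : Function.Injective f := fun i j hij => by
    ext
    rw [← hf i, ← hf j, hij]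
  simpa using Fintype.card_le_of_injective f hinj

/-- If every vertex is within `R` of the gateways, a geodesic is covered by the intervals of
length `2 * R + 1` around the gateways. -/
theorem dist_lt_card_mul (hG : G.Connected) (hS : S.Nonempty) {R : ℕ}
    (hR : ∀ u, gwDist G S u ≤ R) (x y : V) :
    G.dist x y < #S * (2 * R + 1) := by
  have hcover : range (G.dist x y + 1) ⊆
      S.biUnion fun s => Icc (G.dist x s - R) (G.dist x s + R) := by
    intro i hi
    obtain ⟨w, rfl⟩ := exists_dist_eq_of_le_dist hG (Nat.lt_succ_iff.mp (mem_range.mp hi))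
    obtain ⟨s, hs, h⟩ := exists_dist_eq_gwDist (G := G) hS w
    have hw := hR w
    have h₁ : G.dist x s ≤ G.dist x w + G.dist w s := hG.dist_triangle
    have h₂ : G.dist x w ≤ G.dist x s + G.dist s w := hG.dist_triangle
    rw [G.dist_comm (u := s)] at h₂
    simp only [mem_biUnion, mem_Icc]
    exact ⟨s, hs, by omega, by omega⟩
  have h := (card_le_card hcover).trans (card_biUnion_le_card_mul _ _ (2 * R + 1) fun s _ => by
    rw [Nat.card_Icc]
    omega)
  rwa [card_range] at h

theorem comDist_le_sup [Fintype V] (G : SimpleGraph V) (S : Finset V) (v u : V) :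
    comDist G S v u ≤ univ.sup fun u => comDist G S v u :=
  le_sup (f := fun u => comDist G S v u) (mem_univ u)

theorem gwDist_le_two_mul_sup [Fintype V] (hG : G.Connected) (hS : S.Nonempty) (u v : V) :
    gwDist G S u ≤ 2 * univ.sup fun w => comDist G S v w := by
  obtain ⟨s, hs, h⟩ := exists_dist_eq_gwDist (G := G) hS v
  have h₁ := comDist_le_sup G S v u
  have h₂ := comDist_le_sup G S v s
  have h₃ := gwDist_le_dist_add hG hS u v
  generalize (univ.sup fun w => comDist G S v w) = m at h₁ h₂ ⊢
  unfold comDist at h₁ h₂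
  omega

end GatewayDistance

section Cost

variable {V : Type*} [Fintype V] [DecidableEq V] {G : SimpleGraph V} {α : ℝ} {S : Finset V}

theorem maxSocial_eq (G : SimpleGraph V) (α : ℝ) (S : Finset V) :
    maxSocial G α S = α * #S + ∑ v : V, ((univ.sup fun u => comDist G S v u : ℕ) : ℝ) := by
  simp [maxSocial, maxCost, sum_add_distrib, sum_ite_mem, mul_comm]

theorem one_le_maxCost (hG : G.Connected) (hα : 1 ≤ α) (hS : S.Nonempty) (v : V) :
    1 ≤ maxCost G α S v := by
  unfold maxCost
  split_ifs with hv
  · have := Nat.cast_nonneg (α := ℝ) (univ.sup fun u => comDist G S v u)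
    linarith
  · obtain ⟨s, hs, h⟩ := exists_dist_eq_gwDist (G := G) hS v
    have hpos : 0 < G.dist v s := hG.pos_dist_of_ne fun hvs => hv (hvs ▸ hs)
    have h₁ := comDist_le_sup G S v s
    unfold comDist at h₁
    rw [zero_add]
    exact_mod_cast (show 1 ≤ univ.sup fun u => comDist G S v u by unfold comDist; omega)

theorem card_le_maxSocial (hG : G.Connected) (hα : 1 ≤ α) (hS : S.Nonempty) :
    (Fintype.card V : ℝ) ≤ maxSocial G α S := by
  have h := sum_le_sum fun v (_ : v ∈ (univ : Finset V)) => one_le_maxCost hG hα hS v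
  simpa [maxSocial] using h

theorem mul_card_le_maxSocial (G : SimpleGraph V) (α : ℝ) (S : Finset V) :
    α * #S ≤ maxSocial G α S := by
  rw [maxSocial_eq]
  exact le_add_of_nonneg_right (sum_nonneg fun _ _ => Nat.cast_nonneg _)

theorem card_mul_sup_gwDist_le (hG : G.Connected) (hα : 0 ≤ α) (hS : S.Nonempty) :
    (Fintype.card V : ℝ) * (univ.sup (gwDist G S) : ℕ) ≤ 2 * maxSocial G α S := by
  have h : ∀ v ∈ (univ : Finset V), ((univ.sup (gwDist G S) : ℕ) : ℝ) ≤
      2 * ((univ.sup fun u => comDist G S v u : ℕ) : ℝ) := fun v _ => by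
    exact_mod_cast Finset.sup_le fun u _ => gwDist_le_two_mul_sup hG hS u v
  have h' := sum_le_sum h
  rw [← mul_sum, sum_const, card_univ, nsmul_eq_mul] at h'
  rw [maxSocial_eq]
  have : 0 ≤ α * #S := by positivity
  linarith

theorem mul_card_mul_dist_le_sq (hG : G.Connected) (hα : 1 ≤ α) (hS : S.Nonempty) (x y : V) :
    α * Fintype.card V * G.dist x y ≤ 5 * maxSocial G α S ^ 2 := by
  have hα₀ : 0 ≤ α := zero_le_one.trans hα
  have h₁ := mul_card_le_maxSocial G α S
  have h₂ := card_mul_sup_gwDist_le hG hα₀ hS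
  have h₃ := card_le_maxSocial hG hα hS
  have h₄ : (G.dist x y : ℝ) ≤ #S * (2 * (univ.sup (gwDist G S) : ℕ) + 1) := by
    exact_mod_cast (dist_lt_card_mul hG hS (fun u => le_sup (f := gwDist G S) (mem_univ u)) x y).le
  set R : ℝ := ((univ.sup (gwDist G S) : ℕ) : ℝ)
  have hR : 0 ≤ R := Nat.cast_nonneg _
  calc α * Fintype.card V * G.dist x y
      ≤ α * Fintype.card V * (#S * (2 * R + 1)) := by gcongr
    _ = (α * #S) * (Fintype.card V * (2 * R + 1)) := by ring
    _ ≤ maxSocial G α S * (5 * maxSocial G α S) := by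
      refine mul_le_mul h₁ ?_ (by positivity) ((Nat.cast_nonneg _).trans h₃)
      linarith
    _ = 5 * maxSocial G α S ^ 2 := by ring

/-- In a Nash equilibrium any two gateways are at distance at least `α`. -/
theorem MaxNash.le_dist (hNE : MaxNash G α S) {s t : V} (hs : s ∈ S) (ht : t ∈ S) (hst : s ≠ t) :
    α ≤ G.dist s t := by
  have ht' : t ∈ S.erase s := mem_erase.mpr ⟨hst.symm, ht⟩
  have hnot : ¬ maxCost G α (S.erase s) s < maxCost G α S s := fun hlt =>
    hNE _ ⟨s, Or.inr ⟨hs, rfl, ⟨t, ht'⟩⟩, hlt⟩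
  have hsup : (univ.sup fun u => comDist G (S.erase s) s u) ≤
      (univ.sup fun u => comDist G S s u) + G.dist s t := by
    refine Finset.sup_le fun u _ => ?_
    obtain ⟨w, hw, h⟩ := exists_dist_eq_gwDist (G := G) ⟨s, hs⟩ u
    have h₁ := comDist_le_sup G S s u
    have h₂ := gwDist_le (G := G) hs u
    rw [G.dist_comm] at h₂
    have h₃ := gwDist_le (G := G) ht' s
    unfold comDist at h₁ ⊢
    by_cases hws : w = s
    · subst hws
      rw [G.dist_comm] at h
      omega
    · have h₄ := gwDist_le (G := G) (mem_erase.mpr ⟨hws, hw⟩) u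
      omega
  have hsup' : ((univ.sup fun u => comDist G (S.erase s) s u : ℕ) : ℝ) ≤
      ((univ.sup fun u => comDist G S s u : ℕ) : ℝ) + G.dist s t := by exact_mod_cast hsup
  simp only [maxCost, mem_erase, ne_eq, not_true_eq_false, false_and, if_false, if_pos hs,
    not_lt] at hnot
  linarith

theorem MaxNash.mul_card_le (hG : G.Connected) (hα : 0 ≤ α) (hNE : MaxNash G α S) :
    α * #S ≤ α + 2 * Fintype.card V := by
  rcases le_or_gt #S 1 with hcard | hcard
  · have h : (#S : ℝ) ≤ 1 := by exact_mod_cast hcard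
    have h' : (0 : ℝ) ≤ Fintype.card V := Nat.cast_nonneg _
    nlinarith
  have hex : ∀ p : S × Fin ⌈α / 2⌉₊, ∃ w, G.dist p.1 w = p.2 := fun p => by
    obtain ⟨t, ht, hne⟩ := exists_mem_ne hcard (p.1 : V)
    have h₁ := hNE.le_dist p.1.2 ht hne.symm
    have h₂ : ((p.2 : ℕ) : ℝ) < α / 2 := Nat.lt_ceil.mp p.2.2
    have h₃ : ((p.2 : ℕ) : ℝ) ≤ G.dist p.1 t := by linarith
    exact exists_dist_eq_of_le_dist hG (by exact_mod_cast h₃)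
  choose f hf using hex
  have hinj : Function.Injective f := by
    rintro ⟨s, i⟩ ⟨t, j⟩ hij
    have hi := hf (s, i)
    have hj := hf (t, j)
    rw [← hij] at hj
    have hst : s = t := by
      by_contra hne
      have h₁ := hNE.le_dist s.2 t.2 fun h => hne (Subtype.ext h)
      have h₂ : ((i : ℕ) : ℝ) < α / 2 := Nat.lt_ceil.mp i.2
      have h₃ : ((j : ℕ) : ℝ) < α / 2 := Nat.lt_ceil.mp j.2
      have h₄ : G.dist (s : V) t ≤ G.dist s (f (s, i)) + G.dist (f (s, i)) t := hG.dist_triangle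
      rw [G.dist_comm (u := f (s, i)), hi, hj] at h₄
      have h₅ : (G.dist (s : V) t : ℝ) ≤ (i : ℕ) + (j : ℕ) := by exact_mod_cast h₄
      linarith
    subst hst
    rw [show i = j from Fin.ext (hi.symm.trans hj)]
  have hle : #S * ⌈α / 2⌉₊ ≤ Fintype.card V := by
    simpa using Fintype.card_le_of_injective f hinj
  have hle' : (#S : ℝ) * ⌈α / 2⌉₊ ≤ Fintype.card V := by exact_mod_cast hle
  have hceil : (#S : ℝ) * (α / 2) ≤ #S * ⌈α / 2⌉₊ := by
    gcongr
    exact Nat.le_ceil _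
  linarith

end Cost

/-- There is a constant C > 0 such that for every connected graph on n vertices and every
α ≥ 1, every Nash equilibrium S and every nonempty profile S* of the MAX-game satisfy
c(S) ≤ C·(1 + n/√α)·c(S*): the price of anarchy of the MAX-game is O(1 + n/√α). -/
theorem stmt_18 :
    ∃ C : ℝ, 0 < C ∧
      ∀ (V : Type) [Fintype V] [DecidableEq V] (G : SimpleGraph V), G.Connected →
        ∀ α : ℝ, 1 ≤ α →
          ∀ S : Finset V, S.Nonempty → MaxNash G α S →
            ∀ S' : Finset V, S'.Nonempty →
              maxSocial G α S ≤
                C * (1 + (Fintype.card V : ℝ) / Real.sqrt α) * maxSocial G α S' := by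
  refine ⟨3, by norm_num, fun V _ _ G hG α hα S _ hNE S' hS' => ?_⟩
  have hα₀ : 0 < α := zero_lt_one.trans_le hα
  have : Nonempty V := hG.nonempty
  obtain ⟨⟨x, y⟩, -, hmax⟩ :=
    exists_max_image (univ : Finset (V × V)) (fun p => G.dist p.1 p.2) univ_nonempty
  have hecc : ∑ v : V, ((univ.sup fun u => comDist G S v u : ℕ) : ℝ) ≤
      Fintype.card V * G.dist x y := by
    have h : ∀ v ∈ (univ : Finset V),
        ((univ.sup fun u => comDist G S v u : ℕ) : ℝ) ≤ G.dist x y := fun v _ => by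
      exact_mod_cast Finset.sup_le fun u _ => (min_le_left _ _).trans (hmax (v, u) (mem_univ _))
    simpa using sum_le_sum h
  have hsq := mul_card_mul_dist_le_sq hG hα hS' x y
  have hdist : (G.dist x y : ℝ) ≤ Fintype.card V := by exact_mod_cast (dist_lt_card hG x y).le
  have hn := card_le_maxSocial hG hα hS'
  have hS'card : (1 : ℝ) ≤ #S' := by exact_mod_cast hS'.card_pos
  have hαle : α ≤ maxSocial G α S' :=
    (le_mul_of_one_le_right hα₀.le hS'card).trans (mul_card_le_maxSocial G α S')
  have hgates := hNE.mul_card_le hG hα₀.le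
  rw [maxSocial_eq G α S]
  set c := maxSocial G α S'
  set n : ℝ := (Fintype.card V : ℝ)
  set D : ℝ := (G.dist x y : ℝ)
  have hn₀ : 0 ≤ n := Nat.cast_nonneg _
  have hD₀ : 0 ≤ D := Nat.cast_nonneg _
  have hc₀ : 0 ≤ c := hn₀.trans hn
  have hnD : n * D ≤ 3 * (n / √α) * c := by
    have hroot : n * D * √α ≤ 3 * n * c := by
      refine abs_le_of_sq_le_sq' ?_ (by positivity) |>.2
      calc (n * D * √α) ^ 2 = n * D * (α * n * D) := by
            rw [mul_pow, Real.sq_sqrt hα₀.le]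
            ring
        _ ≤ n * n * (5 * c ^ 2) := by gcongr
        _ ≤ (3 * n * c) ^ 2 := by nlinarith [sq_nonneg (n * c)]
    rw [mul_div_assoc', div_mul_eq_mul_div, le_div_iff₀ (Real.sqrt_pos.mpr hα₀)]
    exact hroot
  linarith
end
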